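/- Let ω be a radial weight in the class D̂ and let N∈ℕ with N≥1. Then there exist constants c,C>0, depending only on ω and N, such that for every a∈[3/4,1): c·(1 + ∫_0^a dt/((1−t)^{N+1}·ω̂(t))) ≤ ∑_{j=1}^∞ j^{N−1}·a^j/ω_{2j} ≤ C·(1 + ∫_0^a dt/((1−t)^{N+1}·ω̂(t))). -/

import Mathlib

open MeasureTheory Filter Set
open scoped ENNReal

noncomputable section

/-- `ω̂(r) = ∫_r^1 ω(s) ds`. -/
def omegaHat (ω : ℝ → ℝ) (r : ℝ) : ℝ := ∫ s in r..1, ω s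

/-- A radial weight: nonnegative and Lebesgue integrable on `[0,1)`. -/
def IsRadialWeight (ω : ℝ → ℝ) : Prop :=
  (∀ r ∈ Set.Ico (0:ℝ) 1, 0 ≤ ω r) ∧ MeasureTheory.IntegrableOn ω (Set.Ico 0 1)

/-- The class `D̂` of upper doubling radial weights. -/
def InDhat (ω : ℝ → ℝ) : Prop :=
  ∃ C > (0:ℝ), ∀ r ∈ Set.Ico (0:ℝ) 1, omegaHat ω r ≤ C * omegaHat ω ((1 + r) / 2)

/-- The class `Ď`. -/
def InDcheck (ω : ℝ → ℝ) : Prop :=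
  ∃ K > (1:ℝ), ∃ C > (1:ℝ), ∀ r ∈ Set.Ico (0:ℝ) 1,
    C * omegaHat ω (1 - (1 - r) / K) ≤ omegaHat ω r

/-- Moments `μ_x = ∫_0^1 r^x μ(r) dr`. -/
def momentW (μ : ℝ → ℝ) (x : ℝ) : ℝ := ∫ r in (0:ℝ)..1, r ^ x * μ r

/-- The coefficients `μ_{2k+1}` of the `A²_μ` pairing. -/
def momentCoeff (μ : ℝ → ℝ) : ℕ → ℝ := fun k => momentW μ (2 * (k:ℝ) + 1)

/-- The point `r e^{iθ}` of the circle of radius `r`. -/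
def circlePt (r θ : ℝ) : ℂ := (r:ℂ) * Complex.exp ((θ:ℂ) * Complex.I)

/-- Integral means `M_p(r,f)` (with values in `[0,∞]`). -/
def MpE (p r : ℝ) (f : ℂ → ℂ) : ℝ≥0∞ :=
  (ENNReal.ofReal (1 / (2 * Real.pi)) *
    ∫⁻ θ in Set.Ioo (0:ℝ) (2 * Real.pi), ENNReal.ofReal (‖f (circlePt r θ)‖ ^ p)) ^ (1 / p)

/-- Integral means of a `[0,∞]`-valued function. -/
def MpEE (p r : ℝ) (F : ℂ → ℝ≥0∞) : ℝ≥0∞ :=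
  (ENNReal.ofReal (1 / (2 * Real.pi)) *
    ∫⁻ θ in Set.Ioo (0:ℝ) (2 * Real.pi), (F (circlePt r θ)) ^ p) ^ (1 / p)

/-- The norm of the mixed norm space `L^{p,q}_ω`. -/
def LpqNormE (ω : ℝ → ℝ) (p q : ℝ) (f : ℂ → ℂ) : ℝ≥0∞ :=
  (∫⁻ r in Set.Ioo (0:ℝ) 1, (MpE p r f) ^ q * ENNReal.ofReal (r * ω r)) ^ (1 / q)

/-- The `L^{p,q}_ω` norm of a `[0,∞]`-valued function. -/
def LpqNormEE (ω : ℝ → ℝ) (p q : ℝ) (F : ℂ → ℝ≥0∞) : ℝ≥0∞ :=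
  (∫⁻ r in Set.Ioo (0:ℝ) 1, (MpEE p r F) ^ q * ENNReal.ofReal (r * ω r)) ^ (1 / q)

/-- The norm of `A^{p,∞}_ω` : `sup_{0 ≤ r < 1} M_p(r,f) ω̂(r)`. -/
def ApInfNormE (ω : ℝ → ℝ) (p : ℝ) (f : ℂ → ℂ) : ℝ≥0∞ :=
  ⨆ r ∈ Set.Ico (0:ℝ) 1, MpE p r f * ENNReal.ofReal (omegaHat ω r)

/-- Membership in the mixed norm space `A^{p,q}_ω`. -/
def InApq (ω : ℝ → ℝ) (p q : ℝ) (f : ℂ → ℂ) : Prop :=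
  DifferentiableOn ℂ f (Metric.ball 0 1) ∧ LpqNormE ω p q f < ⊤

/-- Membership in `A^{p,∞}_ω`. -/
def InApInf (ω : ℝ → ℝ) (p : ℝ) (f : ℂ → ℂ) : Prop :=
  DifferentiableOn ℂ f (Metric.ball 0 1) ∧ ApInfNormE ω p f < ⊤

/-- Taylor coefficient of `f` at `0`. -/
def taylorCoeff (f : ℂ → ℂ) (n : ℕ) : ℂ := iteratedDeriv n f 0 / (n.factorial : ℂ)

/-- The pairing `⟨f,g⟩ = lim_{r→1⁻} ∑_k f̂(k) conj(ĝ(k)) c(k) r^k` exists and equals `l`. -/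
def HasPairingC (c : ℕ → ℝ) (f g : ℂ → ℂ) (l : ℂ) : Prop :=
  (∀ r ∈ Set.Ico (0:ℝ) 1, Summable (fun k : ℕ =>
    taylorCoeff f k * (starRingEnd ℂ) (taylorCoeff g k) * ((c k : ℝ) : ℂ) * ((r:ℂ)) ^ k)) ∧
  Filter.Tendsto (fun r : ℝ => ∑' k : ℕ,
    taylorCoeff f k * (starRingEnd ℂ) (taylorCoeff g k) * ((c k : ℝ) : ℂ) * ((r:ℂ)) ^ k)
    (nhdsWithin 1 (Set.Iio 1)) (nhds l)

/-- `L` is linear on the functions satisfying `P`. -/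
def IsLinearOn (P : (ℂ → ℂ) → Prop) (L : (ℂ → ℂ) → ℂ) : Prop :=
  (∀ f g : ℂ → ℂ, P f → P g → L (f + g) = L f + L g) ∧
  (∀ (c : ℂ) (f : ℂ → ℂ), P f → L (c • f) = c * L f)

/-- Dilation `f_r(z) = f(rz)`. -/
def dilateF (f : ℂ → ℂ) (r : ℝ) : ℂ → ℂ := fun z => f ((r:ℂ) * z)

/-- The BMOA norm `|f(0)| + sup_{a∈D} sup_{0<r<1} M₂(r, f∘φ_a - f(a))`. -/
def BMOANormE (f : ℂ → ℂ) : ℝ≥0∞ :=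
  ENNReal.ofReal ‖f 0‖ +
    ⨆ a ∈ Metric.ball (0:ℂ) 1, ⨆ r ∈ Set.Ioo (0:ℝ) 1,
      MpE 2 r (fun z => f ((a - z) / (1 - (starRingEnd ℂ) a * z)) - f a)

/-- The Bloch norm `|f(0)| + sup_{z∈D} (1-|z|²)|f'(z)|`. -/
def BlochNormE (f : ℂ → ℂ) : ℝ≥0∞ :=
  ENNReal.ofReal ‖f 0‖ +
    ⨆ z ∈ Metric.ball (0:ℂ) 1, ENNReal.ofReal ((1 - ‖z‖ ^ 2) * ‖deriv f z‖)

/-- The norm of `X(q,ω)`: `(∫_0^1 ‖f_r‖_X^q ω(r) dr)^{1/q}`. -/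
def XqNormE (Xnorm : (ℂ → ℂ) → ℝ≥0∞) (ω : ℝ → ℝ) (q : ℝ) (f : ℂ → ℂ) : ℝ≥0∞ :=
  (∫⁻ r in Set.Ioo (0:ℝ) 1, (Xnorm (dilateF f r)) ^ q * ENNReal.ofReal (ω r)) ^ (1 / q)

/-- The norm of `X(∞,ω)`: `sup_{0<r<1} ‖f_r‖_X ω̂(r)`. -/
def XInfNormE (Xnorm : (ℂ → ℂ) → ℝ≥0∞) (ω : ℝ → ℝ) (f : ℂ → ℂ) : ℝ≥0∞ :=
  ⨆ r ∈ Set.Ioo (0:ℝ) 1, Xnorm (dilateF f r) * ENNReal.ofReal (omegaHat ω r)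

/-- The standard radial weight `ν_β(r) = (β+1)(1-r²)^β`. -/
def nuWeight (β : ℝ) : ℝ → ℝ := fun r => (β + 1) * (1 - r ^ 2) ^ β

/-- The Bergman reproducing kernel `B^ω_a(z) = ∑ (z conj a)^n / (2 ω_{2n+1})`. -/
def bergmanKernel (ω : ℝ → ℝ) (a z : ℂ) : ℂ :=
  ∑' n : ℕ, (z * (starRingEnd ℂ) a) ^ n / (2 * ((momentW ω (2 * (n:ℝ) + 1) : ℝ) : ℂ))

/-- The Bergman projection (`dA` is normalized area measure). -/
def PomegaProj (ω : ℝ → ℝ) (f : ℂ → ℂ) (z : ℂ) : ℂ :=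
  (Real.pi)⁻¹ • ∫ ζ in Metric.ball (0:ℂ) 1,
    f ζ * (starRingEnd ℂ) (bergmanKernel ω z ζ) * ((ω ‖ζ‖ : ℝ) : ℂ)

/-- The maximal Bergman projection applied to `|f|`, with values in `[0,∞]`. -/
def PomegaPlusL (ω : ℝ → ℝ) (f : ℂ → ℂ) (z : ℂ) : ℝ≥0∞ :=
  ∫⁻ ζ in Metric.ball (0:ℂ) 1,
    ENNReal.ofReal (‖f ζ‖ * ‖bergmanKernel ω z ζ‖ * ω ‖ζ‖ / Real.pi)

/-- The Hardy `H¹` norm. -/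
def H1NormE (f : ℂ → ℂ) : ℝ≥0∞ := ⨆ r ∈ Set.Ioo (0:ℝ) 1, MpE 1 r f

/-- `r_n = inf{ r ∈ [0,1) : ω̂(r) = ω̂(0) K^{-n} }`. -/
def rSeq (ω : ℝ → ℝ) (K : ℝ) (n : ℕ) : ℝ :=
  sInf {r | r ∈ Set.Ico (0:ℝ) 1 ∧ omegaHat ω r = omegaHat ω 0 * K ^ (-(n:ℝ))}

/-- `M_n = ⌊1/(1-r_n)⌋`. -/
def MSeq (ω : ℝ → ℝ) (K : ℝ) (n : ℕ) : ℕ := ⌊1 / (1 - rSeq ω K n)⌋₊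

/-- Weighted Hadamard product of a polynomial with an analytic function:
`z ↦ ∑_j c(j) P̂(j) ĝ(j) z^j`. -/
def hadamardPolyC (c : ℕ → ℂ) (P : Polynomial ℂ) (g : ℂ → ℂ) : ℂ → ℂ :=
  fun z => ∑ j ∈ Finset.range (P.natDegree + 1), c j * P.coeff j * taylorCoeff g j * z ^ j

/-- An admissible Banach space of analytic functions on the unit disc, given by a
carrier set and a norm function. -/
structure AdmissibleSpace where
  carrier : Set (ℂ → ℂ)
  nrm : (ℂ → ℂ) → ℝ
  mem_analytic : ∀ f ∈ carrier, DifferentiableOn ℂ f (Metric.ball 0 1)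
  zero_mem : (0 : ℂ → ℂ) ∈ carrier
  add_mem : ∀ f g : ℂ → ℂ, f ∈ carrier → g ∈ carrier → f + g ∈ carrier
  smul_mem : ∀ (c : ℂ) (f : ℂ → ℂ), f ∈ carrier → c • f ∈ carrier
  nrm_nonneg : ∀ f ∈ carrier, 0 ≤ nrm f
  nrm_eq_zero : ∀ f ∈ carrier, nrm f = 0 → ∀ z ∈ Metric.ball (0:ℂ) 1, f z = 0
  nrm_add : ∀ f g : ℂ → ℂ, f ∈ carrier → g ∈ carrier → nrm (f + g) ≤ nrm f + nrm g
  nrm_smul : ∀ (c : ℂ) (f : ℂ → ℂ), f ∈ carrier → nrm (c • f) = ‖c‖ * nrm f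
  complete : ∀ u : ℕ → (ℂ → ℂ), (∀ n, u n ∈ carrier) →
    (∀ ε : ℝ, 0 < ε → ∃ N : ℕ, ∀ m ≥ N, ∀ n ≥ N, nrm (u m - u n) < ε) →
    ∃ f ∈ carrier, Filter.Tendsto (fun n => nrm (u n - f)) Filter.atTop (nhds 0)
  norm_conv_implies_ucc : ∀ (u : ℕ → (ℂ → ℂ)) (f : ℂ → ℂ),
    (∀ n, u n ∈ carrier) → f ∈ carrier →
    Filter.Tendsto (fun n => nrm (u n - f)) Filter.atTop (nhds 0) →
    ∀ Kc : Set ℂ, Kc ⊆ Metric.ball 0 1 → IsCompact Kc →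
      TendstoUniformlyOn (fun n => u n) f Filter.atTop Kc
  ucc_implies_norm_conv : ∀ R : ℝ, 1 < R → ∀ (u : ℕ → (ℂ → ℂ)) (f : ℂ → ℂ),
    (∀ n, u n ∈ carrier ∧ DifferentiableOn ℂ (u n) (Metric.ball 0 R)) →
    DifferentiableOn ℂ f (Metric.ball 0 R) →
    (∀ Kc : Set ℂ, Kc ⊆ Metric.ball (0:ℂ) R → IsCompact Kc →
      TendstoUniformlyOn (fun n => u n) f Filter.atTop Kc) →
    f ∈ carrier ∧ Filter.Tendsto (fun n => nrm (u n - f)) Filter.atTop (nhds 0)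
  dilation_bound : ∃ C > (0:ℝ), ∀ f ∈ carrier, ∀ ζ : ℂ, ‖ζ‖ ≤ 1 →
    (fun z => f (ζ * z)) ∈ carrier ∧ nrm (fun z => f (ζ * z)) ≤ C * nrm f

/-- The operator `T_p = I^{ν_{1/p-2}}`. -/
def TpOp (p : ℝ) (g : ℂ → ℂ) : ℂ → ℂ :=
  fun z => ∑' k : ℕ,
    taylorCoeff g k * ((momentW (nuWeight (1 / p - 2)) (2 * (k:ℝ) + 1) : ℝ) : ℂ) * z ^ k

/-- Membership in the Bloch space. -/
def InBloch (g : ℂ → ℂ) : Prop :=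
  DifferentiableOn ℂ g (Metric.ball 0 1) ∧ BlochNormE g < ⊤

open Classical in
/-- The norm of the space `X_p = T_p(B)`, normed so that `T_p` is an isometry. -/
def XpNormE (p : ℝ) (h : ℂ → ℂ) : ℝ≥0∞ :=
  if H : ∃ g : ℂ → ℂ, InBloch g ∧ Set.EqOn h (TpOp p g) (Metric.ball 0 1)
  then BlochNormE H.choose else ⊤

/-- The polynomial `V_n ∗ g` where `V_n(z) = ∑_{j=2^{n-1}}^{2^{n+1}-1} ψ(j/2^{n-1}) z^j`
and `ψ(t) = Ψ(t/2) - Ψ(t)`. -/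
def VnStar (Ψ : ℝ → ℝ) (n : ℕ) (g : ℂ → ℂ) : ℂ → ℂ :=
  fun z => ∑ j ∈ Finset.Icc (2 ^ (n - 1) : ℕ) (2 ^ (n + 1) - 1 : ℕ),
    (((Ψ ((j:ℝ) / 2 ^ n) - Ψ ((j:ℝ) / 2 ^ (n - 1))) : ℝ) : ℂ) * taylorCoeff g j * z ^ j

/-- `D^ω(V_n ∗ g)`, where `D^ω h(z) = ∑ ĥ(k) z^k/(2ω_{2k+1})`. -/
def DVnStar (Ψ : ℝ → ℝ) (ω : ℝ → ℝ) (n : ℕ) (g : ℂ → ℂ) : ℂ → ℂ :=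
  fun z => ∑ j ∈ Finset.Icc (2 ^ (n - 1) : ℕ) (2 ^ (n + 1) - 1 : ℕ),
    (((Ψ ((j:ℝ) / 2 ^ n) - Ψ ((j:ℝ) / 2 ^ (n - 1))) : ℝ) : ℂ) * taylorCoeff g j * z ^ j /
      (2 * ((momentW ω (2 * (j:ℝ) + 1) : ℝ) : ℂ))

/-- `J_ω(t) = ∫_0^t ds/(ω̂(s)(1-s))`. -/
def Jomega (ω : ℝ → ℝ) (t : ℝ) : ℝ := ∫ s in (0:ℝ)..t, 1 / (omegaHat ω s * (1 - s))

section OmegaHat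

variable {ω : ℝ → ℝ}

lemma IsRadialWeight.intervalIntegrable (hω : IsRadialWeight ω) {r s : ℝ} (hr : 0 ≤ r)
    (hrs : r ≤ s) (hs : s ≤ 1) : IntervalIntegrable ω volume r s := by
  have h01 : IntervalIntegrable ω volume 0 1 :=
    (intervalIntegrable_iff_integrableOn_Ico_of_le zero_le_one).2 hω.2
  refine h01.mono_set ?_
  rw [uIcc_of_le hrs, uIcc_of_le zero_le_one]
  exact Icc_subset_Icc hr hs

lemma IsRadialWeight.integral_add_omegaHat (hω : IsRadialWeight ω) {r s : ℝ} (hr : 0 ≤ r)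
    (hrs : r ≤ s) (hs : s ≤ 1) : (∫ t in r..s, ω t) + omegaHat ω s = omegaHat ω r :=
  intervalIntegral.integral_add_adjacent_intervals (hω.intervalIntegrable hr hrs hs)
    (hω.intervalIntegrable (hr.trans hrs) hs le_rfl)

lemma IsRadialWeight.integral_nonneg (hω : IsRadialWeight ω) {r s : ℝ} (hr : 0 ≤ r)
    (hrs : r ≤ s) (hs : s ≤ 1) : 0 ≤ ∫ t in r..s, ω t := by
  have h := intervalIntegral.integral_mono_on_of_le_Ioo (μ := volume) hrs
    (intervalIntegrable_const (c := (0 : ℝ))) (hω.intervalIntegrable hr hrs hs)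
    (fun x hx => hω.1 x ⟨hr.trans hx.1.le, hx.2.trans_le hs⟩)
  simpa using h

lemma IsRadialWeight.omegaHat_anti (hω : IsRadialWeight ω) {r s : ℝ} (hr : 0 ≤ r)
    (hrs : r ≤ s) (hs : s ≤ 1) : omegaHat ω s ≤ omegaHat ω r := by
  have h1 := hω.integral_add_omegaHat hr hrs hs
  have h2 := hω.integral_nonneg hr hrs hs
  linarith

/-- Weights in `D̂` have tails of at most polynomial decay. -/
lemma InDhat.exists_growth (hω : IsRadialWeight ω) (hpos : ∀ r ∈ Ico (0:ℝ) 1, 0 < omegaHat ω r)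
    (hD : InDhat ω) : ∃ D > (0:ℝ), ∃ p : ℕ, ∀ r s : ℝ, 0 ≤ r → r ≤ s → s < 1 →
      omegaHat ω r ≤ D * ((1 - r) / (1 - s)) ^ p * omegaHat ω s := by
  obtain ⟨C, hC, h⟩ := hD
  obtain ⟨p, hp⟩ := pow_unbounded_of_one_lt C (one_lt_two (α := ℝ))
  refine ⟨2 ^ p, by positivity, p, fun r s hr hrs hs => ?_⟩
  have iter : ∀ k : ℕ, omegaHat ω r ≤ ((2:ℝ) ^ p) ^ k * omegaHat ω (1 - (1 - r) / 2 ^ k) := by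
    intro k
    induction k with
    | zero => simp
    | succ k ih =>
      have hk : (1:ℝ) ≤ 2 ^ k := one_le_pow₀ one_le_two
      have h1 : 0 < (1 - r) / 2 ^ k := div_pos (by linarith) (by positivity)
      have h2 : (1 - r) / 2 ^ k ≤ 1 := by
        rw [div_le_one (by positivity)]; linarith
      have hm : 1 - (1 - r) / 2 ^ k ∈ Ico (0:ℝ) 1 := ⟨by linarith, by linarith⟩
      have heq : (1 + (1 - (1 - r) / 2 ^ k)) / 2 = 1 - (1 - r) / 2 ^ (k + 1) := by
        field_simp; ring
      have h3 := h _ hm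
      rw [heq] at h3
      have h4 : 0 < omegaHat ω (1 - (1 - r) / 2 ^ (k + 1)) := by
        apply hpos; rw [← heq]; constructor <;> linarith
      calc _ ≤ _ := ih
        _ ≤ ((2:ℝ) ^ p) ^ k * (2 ^ p * omegaHat ω (1 - (1 - r) / 2 ^ (k + 1))) := by
          gcongr
          exact h3.trans (by gcongr)
        _ = _ := by ring
  have hs0 : 0 < 1 - s := by linarith
  obtain ⟨k, hk1, hk2⟩ := exists_nat_pow_near (x := (1 - r) / (1 - s)) (y := (2:ℝ))
    ((one_le_div hs0).2 (by linarith)) one_lt_two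
  have hle : s ≤ 1 - (1 - r) / 2 ^ (k + 1) := by
    rw [div_lt_iff₀ hs0] at hk2
    have : (1 - r) / 2 ^ (k + 1) ≤ 1 - s := by
      rw [div_le_iff₀ (by positivity)]; linarith
    linarith
  have hs' : 0 < omegaHat ω s := hpos s ⟨hr.trans hrs, hs⟩
  calc _ ≤ _ := iter (k + 1)
    _ ≤ ((2:ℝ) ^ p) ^ (k + 1) * omegaHat ω s := by
      gcongr
      refine hω.omegaHat_anti (hr.trans hrs) hle ?_
      have : 0 ≤ (1 - r) / 2 ^ (k + 1) := div_nonneg (by linarith) (by positivity)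
      linarith
    _ = 2 ^ p * (2 ^ k) ^ p * omegaHat ω s := by
      rw [pow_succ, ← pow_mul, ← pow_mul, mul_comm p k]; ring
    _ ≤ _ := by gcongr

lemma momentW_natCast (m : ℕ) : momentW ω m = ∫ r in (0:ℝ)..1, r ^ m * ω r := by
  simp [momentW]

lemma IsRadialWeight.intervalIntegrable_pow_mul (hω : IsRadialWeight ω) (m : ℕ) {r s : ℝ}
    (hr : 0 ≤ r) (hrs : r ≤ s) (hs : s ≤ 1) :
    IntervalIntegrable (fun t => t ^ m * ω t) volume r s :=
  (hω.intervalIntegrable hr hrs hs).continuousOn_mul (by fun_prop)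

lemma IsRadialWeight.omegaHat_le_momentW (hω : IsRadialWeight ω) {m : ℕ} (hm : 0 < m)
    (hm2 : Even m) : omegaHat ω (1 - 1 / m) ≤ 4 * momentW ω m := by
  obtain ⟨k, hk⟩ := hm2.two_dvd
  have hmk : (m:ℝ) = 2 * k := by exact_mod_cast hk
  have hk0 : (1:ℝ) ≤ k := by exact_mod_cast (show 1 ≤ k by omega)
  set s : ℝ := 1 - 1 / m with hs_def
  have hinv : (1:ℝ) / m ≤ 1 / 2 := by
    rw [hmk]; gcongr; linarith
  have hinv0 : (0:ℝ) ≤ 1 / m := by positivity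
  have hs0 : 0 ≤ s := by linarith
  have hs1 : s ≤ 1 := by linarith
  have hquarter : (1:ℝ) / 4 ≤ s ^ m := by
    have h1 := one_add_mul_le_pow (a := -(1 / (m:ℝ))) (by linarith) k
    have h2 : 1 + (k:ℝ) * -(1 / m) = 1 / 2 := by
      rw [hmk]; field_simp; norm_num
    rw [h2, ← sub_eq_add_neg] at h1
    rw [show s ^ m = (s ^ k) ^ 2 by rw [← pow_mul, hk, mul_comm]]
    nlinarith
  rw [momentW_natCast, ← intervalIntegral.integral_add_adjacent_intervals
    (hω.intervalIntegrable_pow_mul m le_rfl hs0 hs1)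
    (hω.intervalIntegrable_pow_mul m hs0 hs1 le_rfl)]
  have h1 : 0 ≤ ∫ t in (0:ℝ)..s, t ^ m * ω t := by
    have h := intervalIntegral.integral_mono_on_of_le_Ioo (μ := volume) hs0
      (intervalIntegrable_const (c := (0 : ℝ))) (hω.intervalIntegrable_pow_mul m le_rfl hs0 hs1)
      (fun x hx => mul_nonneg (pow_nonneg hx.1.le m) (hω.1 x ⟨hx.1.le, hx.2.trans_le hs1⟩))
    simpa using h
  have h2 : (1 / 4) * omegaHat ω s ≤ ∫ t in s..1, t ^ m * ω t := by
    rw [omegaHat, ← intervalIntegral.integral_const_mul]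
    refine intervalIntegral.integral_mono_on_of_le_Ioo hs1
      ((hω.intervalIntegrable hs0 hs1 le_rfl).const_mul _)
      (hω.intervalIntegrable_pow_mul m hs0 hs1 le_rfl) fun x hx => ?_
    have := hω.1 x ⟨hs0.trans hx.1.le, hx.2⟩
    gcongr
    exact hquarter.trans (pow_le_pow_left₀ hs0 hx.1.le m)
  linarith

lemma InDhat.exists_momentW_le (hω : IsRadialWeight ω)
    (hpos : ∀ r ∈ Ico (0:ℝ) 1, 0 < omegaHat ω r) (hD : InDhat ω) :
    ∃ C > (0:ℝ), ∀ m : ℕ, 1 ≤ m → momentW ω m ≤ C * omegaHat ω (1 - 1 / m) := by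
  obtain ⟨D, hD0, p, hg⟩ := hD.exists_growth hω hpos
  have hsum : Summable fun k : ℕ => Real.exp (-k) * ((k:ℝ) + 1) ^ p := by
    have := (summable_nat_add_iff 1).2 (Real.summable_pow_mul_exp_neg_nat_mul p one_pos)
    refine (this.mul_left (Real.exp 1)).congr fun k => ?_
    push_cast
    rw [mul_left_comm, ← Real.exp_add, mul_comm]
    ring_nf
  refine ⟨D * (1 + ∑' k : ℕ, Real.exp (-k) * ((k:ℝ) + 1) ^ p),
    mul_pos hD0 (add_pos_of_pos_of_nonneg one_pos (tsum_nonneg fun k => by positivity)), fun m hm => ?_⟩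
  have hm0 : (0:ℝ) < m := by exact_mod_cast hm
  have hm1 : (1:ℝ) ≤ m := by exact_mod_cast hm
  have hinv : (1:ℝ) / m ≤ 1 := by rw [div_le_one hm0]; exact hm1
  have hinv0 : (0:ℝ) < 1 / m := by positivity
  have hlast : 0 < omegaHat ω (1 - 1 / m) := hpos _ ⟨by linarith, by linarith⟩
  have hx : ∀ j < m, (0:ℝ) ≤ j / m ∧ (j:ℝ) / m ≤ (j + 1 : ℕ) / m ∧ ((j + 1 : ℕ) : ℝ) / m ≤ 1 := by
    intro j hj
    refine ⟨by positivity, by gcongr; simp, ?_⟩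
    rw [div_le_one hm0]; exact_mod_cast hj
  have hpiece : ∀ j ∈ Finset.range m, ∫ t in (j:ℝ) / m..(j + 1 : ℕ) / m, t ^ m * ω t ≤
      D * omegaHat ω (1 - 1 / m) *
        (Real.exp (-((m - 1 - j : ℕ) : ℝ)) * (((m - 1 - j : ℕ) : ℝ) + 1) ^ p) := by
    intro j hj
    have hj := Finset.mem_range.1 hj
    obtain ⟨h0, h1, h2⟩ := hx j hj
    have hcast : ((m - 1 - j : ℕ) : ℝ) = m - 1 - j := by
      rw [Nat.sub_sub, Nat.cast_sub (by omega)]; push_cast; ring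
    have hj' : (j:ℝ) + 1 ≤ m := by exact_mod_cast hj
    have hexp : (((j + 1 : ℕ) : ℝ) / m) ^ m ≤ Real.exp (-((m - 1 - j : ℕ) : ℝ)) := by
      have := Real.one_sub_div_pow_le_exp_neg (n := m) (t := m - 1 - j) (by linarith)
      rw [hcast]
      convert this using 2
      push_cast; field_simp; ring
    have hgr : omegaHat ω (j / m) ≤
        D * (((m - 1 - j : ℕ) : ℝ) + 1) ^ p * omegaHat ω (1 - 1 / m) := by
      have := hg (j / m) (1 - 1 / m) h0 (by
        rw [le_sub_iff_add_le, ← add_div, div_le_one hm0]; exact hj') (by linarith)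
      convert this using 4
      rw [hcast]; field_simp; ring
    calc _ ≤ ∫ t in (j:ℝ) / m..(j + 1 : ℕ) / m, (((j + 1 : ℕ) : ℝ) / m) ^ m * ω t := by
          refine intervalIntegral.integral_mono_on_of_le_Ioo h1
            (hω.intervalIntegrable_pow_mul m h0 h1 h2)
            ((hω.intervalIntegrable h0 h1 h2).const_mul _) fun x hx => ?_
          have := hω.1 x ⟨h0.trans hx.1.le, hx.2.trans_le h2⟩
          have hx0 := h0.trans hx.1.le
          have := hx.2.le
          gcongr
      _ = (((j + 1 : ℕ) : ℝ) / m) ^ m * ∫ t in (j:ℝ) / m..(j + 1 : ℕ) / m, ω t :=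
          intervalIntegral.integral_const_mul _ _
      _ ≤ Real.exp (-((m - 1 - j : ℕ) : ℝ)) * omegaHat ω (j / m) := by
          have e1 := hω.integral_add_omegaHat h0 h1 h2
          have e2 := hω.integral_nonneg (h0.trans h1) h2 le_rfl
          have e3 := hω.integral_nonneg h0 h1 h2
          have e4 : ∫ t in (j:ℝ) / m..(j + 1 : ℕ) / m, ω t ≤ omegaHat ω (j / m) := by
            rw [← e1]; exact le_add_of_nonneg_right e2
          gcongr
      _ ≤ Real.exp (-((m - 1 - j : ℕ) : ℝ)) *
          (D * (((m - 1 - j : ℕ) : ℝ) + 1) ^ p * omegaHat ω (1 - 1 / m)) := by gcongr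
      _ = _ := by ring
  have hadj := intervalIntegral.sum_integral_adjacent_intervals (μ := volume)
    (f := fun t => t ^ m * ω t) (a := fun j : ℕ => (j:ℝ) / m) (n := m)
    (fun j hj => hω.intervalIntegrable_pow_mul m (hx j hj).1 (hx j hj).2.1 (hx j hj).2.2)
  rw [Nat.cast_zero, zero_div, div_self hm0.ne'] at hadj
  rw [momentW_natCast, ← hadj]
  refine (Finset.sum_le_sum hpiece).trans ?_
  rw [← Finset.mul_sum,
    Finset.sum_range_reflect (fun k : ℕ => Real.exp (-(k:ℝ)) * ((k:ℝ) + 1) ^ p) m,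
    mul_right_comm]
  have := hsum.sum_le_tsum (Finset.range m) fun k _ => by positivity
  gcongr
  linarith

end OmegaHat

lemma exists_tsum_pow_mul_geometric_le (q : ℕ) : ∃ A > (0:ℝ), ∀ a ∈ Ico (0:ℝ) 1,
    Summable (fun j : ℕ => ((j:ℝ) + 1) ^ q * a ^ (j + 1)) ∧
      ∑' j : ℕ, ((j:ℝ) + 1) ^ q * a ^ (j + 1) ≤ A / (1 - a) ^ (q + 1) := by
  refine ⟨q.factorial, by positivity, fun a ha => ?_⟩
  have hnorm : ‖a‖ < 1 := by rw [Real.norm_of_nonneg ha.1]; exact ha.2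
  have hle : ∀ j : ℕ, ((j:ℝ) + 1) ^ q * a ^ (j + 1) ≤
      q.factorial * (((j + q).choose q : ℝ) * a ^ j) := by
    intro j
    have h1 : ((j:ℝ) + 1) ^ q ≤ q.factorial * ((j + q).choose q : ℝ) := by
      have := Nat.pow_succ_le_ascFactorial (j + 1) q
      rw [Nat.ascFactorial_eq_factorial_mul_choose] at this
      exact_mod_cast this
    rw [← mul_assoc]
    exact mul_le_mul h1 (pow_le_pow_of_le_one ha.1 ha.2.le j.le_succ)
      (pow_nonneg ha.1 _) (by positivity)
  have hs := (summable_choose_mul_geometric_of_norm_lt_one q hnorm).mul_left (q.factorial : ℝ)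
  have hs' : Summable (fun j : ℕ => ((j:ℝ) + 1) ^ q * a ^ (j + 1)) :=
    hs.of_nonneg_of_le (fun j => mul_nonneg (by positivity) (pow_nonneg ha.1 _)) hle
  refine ⟨hs', (hs'.tsum_le_tsum hle hs).trans (le_of_eq ?_)⟩
  rw [tsum_mul_left, tsum_choose_mul_geometric_of_norm_lt_one q hnorm, mul_one_div]

lemma exp_neg_le_pow {a : ℝ} (ha : a ∈ Ico (3/4 : ℝ) 1) {n : ℕ} (hn : n * (1 - a) ≤ 1) :
    Real.exp (-(4 / 3)) ≤ a ^ n := by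
  have ha0 : 0 < a := by linarith [ha.1]
  rw [← Real.exp_log (pow_pos ha0 n), Real.log_pow]
  apply Real.exp_le_exp.2
  have h1 := Real.one_sub_inv_le_log_of_pos ha0
  have h2 : -(4 / 3) * (1 - a) ≤ 1 - a⁻¹ := by
    rw [← sub_nonneg]
    have : 1 - a⁻¹ - -(4 / 3) * (1 - a) = (1 - a) * (a - 3 / 4) * (4 / 3) / a := by
      field_simp; ring
    rw [this]
    exact div_nonneg (mul_nonneg (mul_nonneg (by linarith [ha.2]) (by linarith [ha.1]))
      (by norm_num)) ha0.le
  calc -(4 / 3) ≤ n * (-(4 / 3) * (1 - a)) := by linarith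
    _ ≤ n * Real.log a := by gcongr; exact h2.trans h1

section Kernel

variable {h : ℝ → ℝ}

lemma monotoneOn_one_div_pow_mul (hanti : AntitoneOn h (Ico 0 1))
    (hpos : ∀ r ∈ Ico (0:ℝ) 1, 0 < h r)
    (n : ℕ) : MonotoneOn (fun t => 1 / ((1 - t) ^ n * h t)) (Ico 0 1) := by
  intro x hx y hy hxy
  have h1 := hpos y hy
  have h2 := hanti hx hy hxy
  have h3 : 0 < 1 - y := by linarith [hy.2]
  have h4 : 0 < 1 - x := by linarith [hx.2]
  dsimp only
  gcongr

lemma MonotoneOn.intervalIntegrable_of_Ico {f : ℝ → ℝ} (hf : MonotoneOn f (Ico 0 1)) {r s : ℝ}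
    (hr : 0 ≤ r) (hrs : r ≤ s) (hs : s < 1) : IntervalIntegrable f volume r s := by
  refine (hf.mono ?_).intervalIntegrable
  rw [uIcc_of_le hrs]
  exact fun x hx => ⟨hr.trans hx.1, hx.2.trans_lt hs⟩

lemma MonotoneOn.mul_le_integral_of_Ico {f : ℝ → ℝ} (hf : MonotoneOn f (Ico 0 1)) {r s : ℝ}
    (hr : 0 ≤ r) (hrs : r ≤ s) (hs : s < 1) : (s - r) * f r ≤ ∫ t in r..s, f t := by
  have := intervalIntegral.integral_mono_on_of_le_Ioo (μ := volume) hrs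
    (intervalIntegrable_const (c := f r)) (hf.intervalIntegrable_of_Ico hr hrs hs)
    (fun x hx => hf ⟨hr, hrs.trans_lt hs⟩ ⟨hr.trans hx.1.le, hx.2.trans hs⟩ hx.1.le)
  simpa using this

lemma MonotoneOn.integral_le_mul_of_Ico {f : ℝ → ℝ} (hf : MonotoneOn f (Ico 0 1)) {r s : ℝ}
    (hr : 0 ≤ r) (hrs : r ≤ s) (hs : s < 1) : ∫ t in r..s, f t ≤ (s - r) * f s := by
  have := intervalIntegral.integral_mono_on_of_le_Ioo (μ := volume) hrs
    (hf.intervalIntegrable_of_Ico hr hrs hs) (intervalIntegrable_const (c := f s))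
    (fun x hx => hf ⟨hr.trans hx.1.le, hx.2.trans hs⟩ ⟨hr.trans hrs, hs⟩ hx.2.le)
  simpa using this

/-- The partition points `1 - 1/(j+1)` of `[0,1)`. -/
def harmonicPt (j : ℕ) : ℝ := 1 - 1 / ((j:ℝ) + 1)

lemma harmonicPt_zero : harmonicPt 0 = 0 := by simp [harmonicPt]

lemma harmonicPt_mem (j : ℕ) : harmonicPt j ∈ Ico (0:ℝ) 1 := by
  have h1 : 1 / ((j:ℝ) + 1) ≤ 1 := by
    rw [div_le_one (by positivity)]; simp
  have h2 : 0 < 1 / ((j:ℝ) + 1) := by positivity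
  constructor <;> unfold harmonicPt <;> linarith

lemma harmonicPt_mono : Monotone harmonicPt := by
  intro i j hij
  unfold harmonicPt
  gcongr

lemma harmonicPt_succ_sub (j : ℕ) :
    harmonicPt (j + 1) - harmonicPt j = 1 / (((j:ℝ) + 1) * (j + 2)) := by
  unfold harmonicPt; push_cast; field_simp; ring

lemma MonotoneOn.sum_integral_harmonicPt {f : ℝ → ℝ} (hf : MonotoneOn f (Ico 0 1)) (K : ℕ) :
    ∑ j ∈ Finset.range K, ∫ t in harmonicPt j..harmonicPt (j + 1), f t =
      ∫ t in (0:ℝ)..harmonicPt K, f t := by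
  rw [intervalIntegral.sum_integral_adjacent_intervals fun j _ =>
    hf.intervalIntegrable_of_Ico (harmonicPt_mem j).1 (harmonicPt_mono j.le_succ)
      (harmonicPt_mem (j + 1)).2, harmonicPt_zero]

lemma integral_harmonicPt_le (hanti : AntitoneOn h (Ico 0 1))
    (hpos : ∀ r ∈ Ico (0:ℝ) 1, 0 < h r)
    (k j : ℕ) : ∫ t in harmonicPt j..harmonicPt (j + 1), 1 / ((1 - t) ^ (k + 2) * h t) ≤
      2 ^ (k + 1) * (((j:ℝ) + 1) ^ k / h (harmonicPt (2 * j + 1))) := by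
  have hp := hpos _ (harmonicPt_mem (2 * j + 1))
  have hle := hanti (harmonicPt_mem (j + 1)) (harmonicPt_mem (2 * j + 1))
    (harmonicPt_mono (by omega))
  refine ((monotoneOn_one_div_pow_mul hanti hpos (k + 2)).integral_le_mul_of_Ico
    (harmonicPt_mem j).1 (harmonicPt_mono j.le_succ) (harmonicPt_mem (j + 1)).2).trans ?_
  have e : 1 - harmonicPt (j + 1) = 1 / ((j:ℝ) + 2) := by
    unfold harmonicPt; push_cast; ring
  rw [harmonicPt_succ_sub, e, one_div_pow]
  calc _ = ((j:ℝ) + 2) ^ (k + 1) / (j + 1) / h (harmonicPt (j + 1)) := by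
        have := hpos _ (harmonicPt_mem (j + 1))
        field_simp
        ring
    _ ≤ (2 * ((j:ℝ) + 1)) ^ (k + 1) / (j + 1) / h (harmonicPt (2 * j + 1)) := by
        gcongr; linarith
    _ = _ := by rw [mul_pow]; field_simp; ring

lemma le_integral_harmonicPt (hanti : AntitoneOn h (Ico 0 1))
    (hpos : ∀ r ∈ Ico (0:ℝ) 1, 0 < h r)
    (k j : ℕ) : ((j:ℝ) + 1) ^ k / h (harmonicPt j) ≤
      2 * ∫ t in harmonicPt j..harmonicPt (j + 1), 1 / ((1 - t) ^ (k + 2) * h t) := by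
  have hp := hpos _ (harmonicPt_mem j)
  have hle := (monotoneOn_one_div_pow_mul hanti hpos (k + 2)).mul_le_integral_of_Ico
    (harmonicPt_mem j).1 (harmonicPt_mono j.le_succ) (harmonicPt_mem (j + 1)).2
  have e : 1 - harmonicPt j = 1 / ((j:ℝ) + 1) := by unfold harmonicPt; ring
  rw [harmonicPt_succ_sub, e, one_div_pow] at hle
  refine le_trans ?_ (mul_le_mul_of_nonneg_left hle zero_le_two)
  calc _ = (2 * (((j:ℝ) + 1) ^ (k + 1) / (2 * (j + 1)))) / h (harmonicPt j) := by
        field_simp; ring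
    _ ≤ (2 * (((j:ℝ) + 1) ^ (k + 1) / (j + 2))) / h (harmonicPt j) := by
        gcongr; linarith
    _ = _ := by field_simp; ring

lemma lower_bound_of_moments (hanti : AntitoneOn h (Ico 0 1))
    (hpos : ∀ r ∈ Ico (0:ℝ) 1, 0 < h r)
    {m : ℕ → ℝ} (hm0 : ∀ j, 0 < m j) {C : ℝ} (hC : 0 < C)
    (hm : ∀ j, m j ≤ C * h (harmonicPt (2 * j + 1))) (k : ℕ) :
    ∃ c > (0:ℝ), ∀ a ∈ Ico (3/4 : ℝ) 1,
      Summable (fun j : ℕ => ((j:ℝ) + 1) ^ k * a ^ (j + 1) / m j) →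
      c * (1 + ∫ t in (0:ℝ)..a, 1 / ((1 - t) ^ (k + 2) * h t)) ≤
        ∑' j : ℕ, ((j:ℝ) + 1) ^ k * a ^ (j + 1) / m j := by
  set E : ℝ := 2 ^ (k + 1) * (Real.exp (4 / 3) * C) with hE
  have hm00 := hm0 0
  refine ⟨1 / (4 / 3 * m 0 + E), by positivity, fun a ha hsum => ?_⟩
  set S := ∑' j : ℕ, ((j:ℝ) + 1) ^ k * a ^ (j + 1) / m j with hS
  have ha0 : 0 < a := by linarith [ha.1]
  have ha1 : 0 < 1 - a := by linarith [ha.2]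
  have hT : ∀ j : ℕ, 0 ≤ ((j:ℝ) + 1) ^ k * a ^ (j + 1) / m j := fun j => by
    have := hm0 j
    positivity
  have hone : 1 ≤ 4 / 3 * m 0 * S := by
    have h1 := hsum.sum_le_tsum (Finset.range 1) fun j _ => hT j
    simp only [Finset.range_one, Finset.sum_singleton, Nat.cast_zero, zero_add, one_pow, pow_one,
      one_mul] at h1
    calc (1:ℝ) ≤ 4 / 3 * a := by linarith [ha.1]
      _ = 4 / 3 * m 0 * (a / m 0) := by field_simp
      _ ≤ _ := by gcongr
  have hf := monotoneOn_one_div_pow_mul hanti hpos (k + 2)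
  set K : ℕ := ⌈1 / (1 - a)⌉₊ - 1
  have hceil : 1 ≤ ⌈1 / (1 - a)⌉₊ := Nat.one_le_ceil_iff.2 (by positivity)
  have hK1 : (K:ℝ) + 1 = ⌈1 / (1 - a)⌉₊ := by exact_mod_cast Nat.sub_add_cancel hceil
  have hK2 : K * (1 - a) ≤ 1 := by
    rw [← le_div_iff₀ ha1]
    have := Nat.ceil_lt_add_one (a := 1 / (1 - a)) (by positivity)
    linarith
  have hK3 : a ≤ harmonicPt K := by
    have : 1 / ((K:ℝ) + 1) ≤ 1 - a := by
      rw [hK1, one_div_le (by exact_mod_cast hceil) ha1]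
      exact Nat.le_ceil _
    unfold harmonicPt; linarith
  have hint : ∫ t in (0:ℝ)..a, 1 / ((1 - t) ^ (k + 2) * h t) ≤ E * S := by
    calc _ ≤ ∫ t in (0:ℝ)..harmonicPt K, 1 / ((1 - t) ^ (k + 2) * h t) := by
          have hadd := intervalIntegral.integral_add_adjacent_intervals
            (hf.intervalIntegrable_of_Ico le_rfl ha0.le ha.2)
            (hf.intervalIntegrable_of_Ico ha0.le hK3 (harmonicPt_mem K).2)
          have hnn := hf.mul_le_integral_of_Ico ha0.le hK3 (harmonicPt_mem K).2
          have hha := hpos a ⟨ha0.le, ha.2⟩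
          have : 0 ≤ (harmonicPt K - a) * (1 / ((1 - a) ^ (k + 2) * h a)) :=
            mul_nonneg (by linarith) (by positivity)
          linarith
      _ = ∑ j ∈ Finset.range K, ∫ t in harmonicPt j..harmonicPt (j + 1),
            1 / ((1 - t) ^ (k + 2) * h t) := (hf.sum_integral_harmonicPt K).symm
      _ ≤ ∑ j ∈ Finset.range K, E * (((j:ℝ) + 1) ^ k * a ^ (j + 1) / m j) := by
          refine Finset.sum_le_sum fun j hj => (integral_harmonicPt_le hanti hpos k j).trans ?_
          have hjK : ((j + 1 : ℕ) : ℝ) ≤ K := by exact_mod_cast Finset.mem_range.1 hj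
          have hpow : Real.exp (-(4 / 3)) ≤ a ^ (j + 1) := exp_neg_le_pow ha
            ((mul_le_mul_of_nonneg_right hjK ha1.le).trans hK2)
          have hpow' : 1 ≤ Real.exp (4 / 3) * a ^ (j + 1) := by
            calc (1:ℝ) = Real.exp (4 / 3) * Real.exp (-(4 / 3)) := by
                  rw [← Real.exp_add]; simp
              _ ≤ _ := by gcongr
          have hmj := hm0 j
          have hhj := hpos _ (harmonicPt_mem (2 * j + 1))
          have hinv : 1 / h (harmonicPt (2 * j + 1)) ≤ C * (1 / m j) := by
            rw [mul_one_div, div_le_div_iff₀ hhj hmj, one_mul]; exact hm j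
          rw [hE, mul_assoc]
          gcongr
          calc ((j:ℝ) + 1) ^ k / h (harmonicPt (2 * j + 1))
              = ((j:ℝ) + 1) ^ k * (1 / h (harmonicPt (2 * j + 1))) * 1 := by ring
            _ ≤ ((j:ℝ) + 1) ^ k * (C * (1 / m j)) * (Real.exp (4 / 3) * a ^ (j + 1)) := by gcongr
            _ = _ := by ring
      _ = E * ∑ j ∈ Finset.range K, ((j:ℝ) + 1) ^ k * a ^ (j + 1) / m j :=
          (Finset.mul_sum _ _ _).symm
      _ ≤ E * S := by
          gcongr
          exact hsum.sum_le_tsum _ fun j _ => hT j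
  rw [one_div_mul_eq_div, div_le_iff₀ (by positivity)]
  linarith

lemma upper_bound_of_moments (hanti : AntitoneOn h (Ico 0 1))
    (hpos : ∀ r ∈ Ico (0:ℝ) 1, 0 < h r)
    {D : ℝ} (hD : 0 < D) {p : ℕ} (hg : ∀ r s : ℝ, 0 ≤ r → r ≤ s → s < 1 →
      h r ≤ D * ((1 - r) / (1 - s)) ^ p * h s)
    {m : ℕ → ℝ} (hm : ∀ j, h (harmonicPt (2 * j + 1)) ≤ 4 * m j) (k : ℕ) :
    ∃ C > (0:ℝ), ∀ a ∈ Ico (3/4 : ℝ) 1,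
      Summable (fun j : ℕ => ((j:ℝ) + 1) ^ k * a ^ (j + 1) / m j) ∧
      ∑' j : ℕ, ((j:ℝ) + 1) ^ k * a ^ (j + 1) / m j ≤
        C * ∫ t in (0:ℝ)..a, 1 / ((1 - t) ^ (k + 2) * h t) := by
  obtain ⟨A, hA, hgeom⟩ := exists_tsum_pow_mul_geometric_le (k + p)
  have hm0 : ∀ j, 0 < m j := fun j => by
    have := hpos _ (harmonicPt_mem (2 * j + 1))
    linarith [hm j]
  have he : ∀ j : ℕ, 1 - harmonicPt (2 * j + 1) = 1 / (2 * ((j:ℝ) + 1)) := fun j => by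
    unfold harmonicPt; push_cast; ring
  have hinv : ∀ (j : ℕ) (r : ℝ), 0 ≤ r → r ≤ harmonicPt (2 * j + 1) →
      1 / m j ≤ 4 * D * 2 ^ p * (1 - r) ^ p * ((j:ℝ) + 1) ^ p / h r := by
    intro j r hr hrj
    have h1 := hg r _ hr hrj (harmonicPt_mem _).2
    have h2 := hpos r ⟨hr, hrj.trans_lt (harmonicPt_mem _).2⟩
    have h3 : 0 ≤ 1 - r := by linarith [(harmonicPt_mem (2 * j + 1)).2]
    rw [div_le_div_iff₀ (hm0 j) h2, one_mul]
    calc h r ≤ _ := h1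
      _ ≤ D * ((1 - r) / (1 - harmonicPt (2 * j + 1))) ^ p * (4 * m j) := by
          have h4 : 0 ≤ (1 - r) / (1 - harmonicPt (2 * j + 1)) :=
            div_nonneg h3 (by linarith [(harmonicPt_mem (2 * j + 1)).2])
          exact mul_le_mul_of_nonneg_left (hm j) (by positivity)
      _ = _ := by
          rw [he, div_div_eq_mul_div, div_one, mul_pow, mul_pow]; ring
  refine ⟨8 * D * 2 ^ p + 4 * D * 2 ^ p * A * (2 ^ (k + 2) * D * 2 ^ p), by positivity,
    fun a ha => ?_⟩
  have ha0 : 0 < a := by linarith [ha.1]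
  have ha1 : 0 < 1 - a := by linarith [ha.2]
  have hha := hpos a ⟨ha0.le, ha.2⟩
  obtain ⟨hgs, hgle⟩ := hgeom a ⟨ha0.le, ha.2⟩
  have hf := monotoneOn_one_div_pow_mul hanti hpos (k + 2)
  have hh0 := hpos 0 ⟨le_rfl, one_pos⟩
  have hT : ∀ j : ℕ, 0 ≤ ((j:ℝ) + 1) ^ k * a ^ (j + 1) / m j := fun j => by
    have := hm0 j
    positivity
  have hsum : Summable (fun j : ℕ => ((j:ℝ) + 1) ^ k * a ^ (j + 1) / m j) := by
    refine (hgs.mul_left (4 * D * 2 ^ p / h 0)).of_nonneg_of_le hT fun j => ?_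
    calc _ = ((j:ℝ) + 1) ^ k * a ^ (j + 1) * (1 / m j) := by ring
      _ ≤ ((j:ℝ) + 1) ^ k * a ^ (j + 1) *
          (4 * D * 2 ^ p * (1 - 0) ^ p * ((j:ℝ) + 1) ^ p / h 0) := by
          exact mul_le_mul_of_nonneg_left (hinv j 0 le_rfl (harmonicPt_mem _).1) (by positivity)
      _ = _ := by rw [sub_zero, one_pow, pow_add]; ring
  refine ⟨hsum, ?_⟩
  set I := ∫ t in (0:ℝ)..a, 1 / ((1 - t) ^ (k + 2) * h t) with hI
  have hnonneg : ∀ r s : ℝ, 0 ≤ r → r ≤ s → s < 1 →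
      0 ≤ ∫ t in r..s, 1 / ((1 - t) ^ (k + 2) * h t) := by
    intro r s hr hrs hs
    refine le_trans (mul_nonneg (by linarith) ?_) (hf.mul_le_integral_of_Ico hr hrs hs)
    have := hpos r ⟨hr, by linarith⟩
    have : 0 < 1 - r := by linarith
    positivity
  have hsplit : ∀ r : ℝ, 0 ≤ r → r ≤ a →
      (∫ t in (0:ℝ)..r, 1 / ((1 - t) ^ (k + 2) * h t)) +
        ∫ t in r..a, 1 / ((1 - t) ^ (k + 2) * h t) = I := fun r hr hra =>
    intervalIntegral.integral_add_adjacent_intervals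
      (hf.intervalIntegrable_of_Ico le_rfl hr (hra.trans_lt ha.2))
      (hf.intervalIntegrable_of_Ico hr hra ha.2)
  set K : ℕ := ⌊1 / (1 - a)⌋₊ - 1
  have hMa : 2 ≤ 1 / (1 - a) := by
    rw [le_div_iff₀ ha1]; linarith [ha.1]
  have hfloor : 1 ≤ ⌊1 / (1 - a)⌋₊ := (Nat.one_le_floor_iff _).2 (by linarith)
  have hK1 : (K:ℝ) + 1 = ⌊1 / (1 - a)⌋₊ := by exact_mod_cast Nat.sub_add_cancel hfloor
  have hKa : harmonicPt K ≤ a := by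
    have : 1 - a ≤ 1 / ((K:ℝ) + 1) := by
      rw [le_one_div ha1 (by positivity), hK1]
      exact Nat.floor_le (by positivity)
    unfold harmonicPt; linarith
  have haK : ∀ j, K ≤ j → a ≤ harmonicPt (2 * j + 1) := by
    intro j hj
    have h1 := Nat.lt_floor_add_one (1 / (1 - a))
    have h2 : (K:ℝ) ≤ j := by exact_mod_cast hj
    have h3 : 1 / (2 * ((j:ℝ) + 1)) ≤ 1 - a := by
      rw [one_div_le (by positivity) ha1]
      have h4 : (0:ℝ) ≤ K := by positivity
      linarith
    linarith [he j]
  have hhead : ∑ j ∈ Finset.range K, ((j:ℝ) + 1) ^ k * a ^ (j + 1) / m j ≤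
      8 * D * 2 ^ p * I := by
    calc _ ≤ ∑ j ∈ Finset.range K, 8 * D * 2 ^ p *
          ∫ t in harmonicPt j..harmonicPt (j + 1), 1 / ((1 - t) ^ (k + 2) * h t) := by
          refine Finset.sum_le_sum fun j _ => ?_
          have hp := hpos _ (harmonicPt_mem j)
          have h1 := hinv j _ (harmonicPt_mem j).1 (harmonicPt_mono (by omega))
          have h2 : (1 - harmonicPt j) ^ p * ((j:ℝ) + 1) ^ p = 1 := by
            rw [← mul_pow]
            unfold harmonicPt
            rw [sub_sub_cancel, one_div_mul_cancel (by positivity), one_pow]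
          rw [mul_assoc, h2, mul_one] at h1
          have h3 : a ^ (j + 1) ≤ 1 := pow_le_one₀ ha0.le ha.2.le
          have hmj := hm0 j
          calc _ = ((j:ℝ) + 1) ^ k * a ^ (j + 1) * (1 / m j) := by ring
            _ ≤ ((j:ℝ) + 1) ^ k * 1 * (4 * D * 2 ^ p / h (harmonicPt j)) := by gcongr
            _ = 4 * D * 2 ^ p * (((j:ℝ) + 1) ^ k / h (harmonicPt j)) := by ring
            _ ≤ 4 * D * 2 ^ p * (2 * _) := by
                gcongr
                exact le_integral_harmonicPt hanti hpos k j
            _ = _ := by ring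
      _ = 8 * D * 2 ^ p * ∫ t in (0:ℝ)..harmonicPt K, 1 / ((1 - t) ^ (k + 2) * h t) := by
          rw [← Finset.mul_sum, hf.sum_integral_harmonicPt]
      _ ≤ _ := by
          gcongr
          have h1 := hsplit _ (harmonicPt_mem K).1 hKa
          have h2 := hnonneg _ _ (harmonicPt_mem K).1 hKa ha.2
          linarith
  have hlast : 1 / ((1 - a) ^ (k + 1) * h a) ≤ 2 ^ (k + 2) * D * 2 ^ p * I := by
    have hr0 : 0 ≤ 2 * a - 1 := by linarith [ha.1]
    have hra : 2 * a - 1 ≤ a := by linarith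
    have h1 := hsplit _ hr0 hra
    have h2 := hnonneg _ _ le_rfl hr0 (hra.trans_lt ha.2)
    have h3 := hf.mul_le_integral_of_Ico hr0 hra ha.2
    have h4 := hg _ _ hr0 hra ha.2
    have h5 := hpos _ ⟨hr0, hra.trans_lt ha.2⟩
    have e1 : 1 - (2 * a - 1) = 2 * (1 - a) := by ring
    have e2 : a - (2 * a - 1) = 1 - a := by ring
    simp only [e1, e2] at h3
    rw [e1, mul_div_cancel_right₀ _ ha1.ne'] at h4
    have h6 : 1 / h a ≤ D * 2 ^ p * (1 / h (2 * a - 1)) := by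
      rw [mul_one_div, div_le_div_iff₀ hha h5, one_mul]; exact h4
    calc 1 / ((1 - a) ^ (k + 1) * h a) = 1 / (1 - a) ^ (k + 1) * (1 / h a) := by
          rw [one_div_mul_one_div]
      _ ≤ 1 / (1 - a) ^ (k + 1) * (D * 2 ^ p * (1 / h (2 * a - 1))) := by gcongr
      _ = 2 ^ (k + 2) * D * 2 ^ p *
          ((1 - a) * (1 / ((2 * (1 - a)) ^ (k + 2) * h (2 * a - 1)))) := by
          rw [mul_pow]; field_simp; ring
      _ ≤ _ := by gcongr; linarith
  have htail : ∑' j : ℕ, (((j + K : ℕ):ℝ) + 1) ^ k * a ^ (j + K + 1) / m (j + K) ≤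
      4 * D * 2 ^ p * A * (2 ^ (k + 2) * D * 2 ^ p) * I := by
    set B : ℝ := 4 * D * 2 ^ p * (1 - a) ^ p / h a with hB
    calc _ ≤ ∑' j : ℕ, B * ((((j + K : ℕ):ℝ) + 1) ^ (k + p) * a ^ (j + K + 1)) := by
          refine ((summable_nat_add_iff K).2 hsum).tsum_le_tsum (fun j => ?_)
            (((summable_nat_add_iff K).2 hgs).mul_left B)
          have h1 := hinv (j + K) a ha0.le (haK _ (Nat.le_add_left _ _))
          calc _ = (((j + K : ℕ):ℝ) + 1) ^ k * a ^ (j + K + 1) * (1 / m (j + K)) := by ring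
            _ ≤ _ := mul_le_mul_of_nonneg_left h1 (by positivity)
            _ = _ := by rw [hB, pow_add _ k p]; ring
      _ = B * ∑' j : ℕ, (((j + K : ℕ):ℝ) + 1) ^ (k + p) * a ^ (j + K + 1) := tsum_mul_left
      _ ≤ B * ∑' j : ℕ, ((j:ℝ) + 1) ^ (k + p) * a ^ (j + 1) := by
          refine mul_le_mul_of_nonneg_left ?_ (by positivity)
          rw [← hgs.sum_add_tsum_nat_add K]
          exact le_add_of_nonneg_left (Finset.sum_nonneg fun j _ => by positivity)
      _ ≤ B * (A / (1 - a) ^ (k + p + 1)) := by gcongr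
      _ = 4 * D * 2 ^ p * A * (1 / ((1 - a) ^ (k + 1) * h a)) := by
          rw [hB, show k + p + 1 = p + (k + 1) by ring, pow_add (1 - a) p]; field_simp
      _ ≤ 4 * D * 2 ^ p * A * (2 ^ (k + 2) * D * 2 ^ p * I) := by gcongr
      _ = _ := by ring
  rw [← hsum.sum_add_tsum_nat_add K, add_mul]
  exact add_le_add hhead htail

end Kernel

/-- For `ω ∈ D̂` and `N ≥ 1`,
`∑_{j≥1} j^{N-1} a^j / ω_{2j} ≍ 1 + ∫_0^a dt/((1-t)^{N+1} ω̂(t))` for `3/4 ≤ a < 1`. -/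
theorem moment_sum_asymptotics
    (ω : ℝ → ℝ) (hω : IsRadialWeight ω)
    (hpos : ∀ r ∈ Set.Ico (0:ℝ) 1, 0 < omegaHat ω r)
    (hD : InDhat ω)
    (N : ℕ) (hN : 1 ≤ N) :
    ∃ c > (0:ℝ), ∃ C > (0:ℝ), ∀ a ∈ Set.Ico (3/4 : ℝ) 1,
      c * (1 + ∫ t in (0:ℝ)..a, 1 / ((1 - t) ^ (N + 1) * omegaHat ω t)) ≤
          (∑' j : ℕ, ((j:ℝ) + 1) ^ (N - 1) * a ^ (j + 1) / momentW ω (2 * ((j:ℝ) + 1))) ∧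
      (∑' j : ℕ, ((j:ℝ) + 1) ^ (N - 1) * a ^ (j + 1) / momentW ω (2 * ((j:ℝ) + 1))) ≤
          C * (1 + ∫ t in (0:ℝ)..a, 1 / ((1 - t) ^ (N + 1) * omegaHat ω t)) := by
  obtain ⟨k, rfl⟩ : ∃ k, N = k + 1 := ⟨N - 1, by omega⟩
  have hanti : AntitoneOn (omegaHat ω) (Ico 0 1) := fun r hr s hs hrs =>
    hω.omegaHat_anti hr.1 hrs hs.2.le
  have hcast : ∀ j : ℕ, 2 * ((j:ℝ) + 1) = ((2 * (j + 1) : ℕ) : ℝ) := fun j => by push_cast; ring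
  have hpt : ∀ j : ℕ, 1 - 1 / ((2 * (j + 1) : ℕ) : ℝ) = harmonicPt (2 * j + 1) := fun j => by
    unfold harmonicPt; push_cast; ring
  obtain ⟨D, hD0, p, hg⟩ := hD.exists_growth hω hpos
  obtain ⟨M, hM0, hM⟩ := hD.exists_momentW_le hω hpos
  have hlow : ∀ j : ℕ,
      omegaHat ω (harmonicPt (2 * j + 1)) ≤ 4 * momentW ω (2 * ((j:ℝ) + 1)) := fun j => by
    rw [← hpt, hcast]
    exact hω.omegaHat_le_momentW (by omega) (even_two_mul _)
  have hupp : ∀ j : ℕ,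
      momentW ω (2 * ((j:ℝ) + 1)) ≤ M * omegaHat ω (harmonicPt (2 * j + 1)) := fun j => by
    rw [← hpt, hcast]
    exact hM _ (by omega)
  have hm0 : ∀ j : ℕ, 0 < momentW ω (2 * ((j:ℝ) + 1)) := fun j => by
    linarith [hlow j, hpos _ (harmonicPt_mem (2 * j + 1))]
  obtain ⟨c, hc, hlower⟩ := lower_bound_of_moments hanti hpos hm0 hM0 hupp k
  obtain ⟨C, hC, hupper⟩ := upper_bound_of_moments hanti hpos hD0 hg hlow k
  refine ⟨c, hc, C, hC, fun a ha => ?_⟩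
  obtain ⟨hsum, hle⟩ := hupper a ha
  exact ⟨hlower a ha hsum, hle.trans (by gcongr; linarith)⟩
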